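/- Suppose q > 1 belongs to the closure of the set U of univoque numbers. Then the set V_q ∖ U_q is countably infinite and is dense in V_q. -/

import Mathlib

open Classical

noncomputable section

/-- The largest digit in base `q`: `α₁ = ⌈q⌉ - 1`. -/
def alphaOne (q : ℝ) : ℕ := (⌈q⌉ - 1).toNat

/-- `c` (0-indexed: `c i` is the digit `c_{i+1}` of the paper) is an expansion of `x`
in base `q`: all digits lie in `{0, …, α₁}` and `x = ∑_{i≥1} c_i q^{-i}`. -/
def IsExpansionOf (q x : ℝ) (c : ℕ → ℕ) : Prop :=
  (∀ i, c i ≤ alphaOne q) ∧ x = ∑' i, (c i : ℝ) / q ^ (i + 1)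

/-- A sequence is called infinite if it has infinitely many nonzero terms. -/
def InfiniteSeq (c : ℕ → ℕ) : Prop := {i | c i ≠ 0}.Infinite

/-- Strict lexicographic order on sequences. -/
def LexLt (a b : ℕ → ℕ) : Prop := ∃ n, (∀ i, i < n → a i = b i) ∧ a n < b n

/-- Lexicographic order `≤` on sequences. -/
def LexLe (a b : ℕ → ℕ) : Prop := LexLt a b ∨ a = b

/-- `b` is the greedy (lexicographically largest) expansion of `x` in base `q`. -/
def IsGreedyOf (q x : ℝ) (b : ℕ → ℕ) : Prop :=
  IsExpansionOf q x b ∧ ∀ c, IsExpansionOf q x c → LexLe c b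

/-- `a` is the quasi-greedy (lexicographically largest infinite) expansion of `x`
in base `q`. -/
def IsQuasiGreedyOf (q x : ℝ) (a : ℕ → ℕ) : Prop :=
  IsExpansionOf q x a ∧ InfiniteSeq a ∧
    ∀ c, IsExpansionOf q x c → InfiniteSeq c → LexLe c a

/-- The quasi-greedy expansion of `x` in base `q`; by convention it is the zero
sequence whenever no infinite expansion exists (in particular for `x = 0`). -/
def quasiGreedy (q x : ℝ) : ℕ → ℕ :=
  if h : ∃ a, IsQuasiGreedyOf q x a then h.choose else fun _ => 0

/-- The greedy expansion of `x` in base `q` (zero sequence if `x` has no expansion). -/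
def greedy (q x : ℝ) : ℕ → ℕ :=
  if h : ∃ b, IsGreedyOf q x b then h.choose else fun _ => 0

/-- The interval `J_q = [0, α₁/(q-1)]`. -/
def Jq (q : ℝ) : Set ℝ := Set.Icc 0 ((alphaOne q : ℝ) / (q - 1))

/-- `U_q`: the set of real numbers having exactly one expansion in base `q`. -/
def Uq (q : ℝ) : Set ℝ := {x | ∃! c, IsExpansionOf q x c}

/-- `U_q'`: the set of univoque sequences in base `q`. -/
def UqSeq (q : ℝ) : Set (ℕ → ℕ) := {c | ∃ x ∈ Uq q, IsExpansionOf q x c}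

/-- `U`: the set of univoque numbers. -/
def USet : Set ℝ := {q | 1 < q ∧ ∃! c, IsExpansionOf q 1 c}

/-- `V_q`: the set of `x ∈ J_q` such that for every `n ≥ 1` with `a_n(x) > 0` the
conjugated shifted quasi-greedy expansion is lexicographically at most `(α_i)`. -/
def Vq (q : ℝ) : Set ℝ :=
  {x | x ∈ Jq q ∧ ∀ n, 0 < quasiGreedy q x n →
    LexLe (fun i => alphaOne q - quasiGreedy q x (n + 1 + i)) (quasiGreedy q 1)}

/-- `V`: the set of `q > 1` whose quasi-greedy expansion `(α_i)` of `1` satisfies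
`(α₁ - α_{k+i})_{i≥1} ≤ (α_i)_{i≥1}` lexicographically for all `k ≥ 1`. -/
def VSet : Set ℝ :=
  {q | 1 < q ∧ ∀ k, LexLe (fun i => alphaOne q - quasiGreedy q 1 (k + 1 + i)) (quasiGreedy q 1)}

/-- The value `∑ c_i q^{-i}` of a digit sequence. -/
def bval (q : ℝ) (c : ℕ → ℕ) : ℝ := ∑' i, (c i : ℝ) / q ^ (i + 1)

/-- The sequence obtained by deleting the first `n` digits. -/
def seqDrop (n : ℕ) (c : ℕ → ℕ) : ℕ → ℕ := fun i => c (n + i)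

/-- The right endpoint of `J_q`. -/
def maxVal (q : ℝ) : ℝ := (alphaOne q : ℝ) / (q - 1)

/-- The conjugate of a digit sequence. -/
def conjSeq (q : ℝ) (c : ℕ → ℕ) : ℕ → ℕ := fun i => alphaOne q - c i

/-- Digit sequences whose tails satisfy the weak form of the univoque inequalities. -/
def Good (q : ℝ) (c : ℕ → ℕ) : Prop :=
  (∀ i, c i ≤ alphaOne q) ∧
    (∀ n, c n < alphaOne q → bval q (seqDrop (n + 1) c) ≤ 1) ∧
    ∀ n, 0 < c n → maxVal q - 1 ≤ bval q (seqDrop (n + 1) c)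

/-- One of the weak univoque inequalities is an equality. -/
def Crit (q : ℝ) (c : ℕ → ℕ) : Prop :=
  ∃ n, (c n < alphaOne q ∧ bval q (seqDrop (n + 1) c) = 1) ∨
    (0 < c n ∧ bval q (seqDrop (n + 1) c) = maxVal q - 1)

lemma seqDrop_seqDrop (m n : ℕ) (c : ℕ → ℕ) :
    seqDrop m (seqDrop n c) = seqDrop (n + m) c := by
  funext i; simp [seqDrop, add_assoc]

lemma seqDrop_zero (c : ℕ → ℕ) : seqDrop 0 c = c := by
  funext i; simp [seqDrop]

lemma alphaOne_cast {q : ℝ} (hq : 1 < q) : (alphaOne q : ℝ) = ⌈q⌉ - 1 := by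
  have h : (1 : ℤ) < ⌈q⌉ := by rw [Int.lt_ceil]; exact_mod_cast hq
  have : ((alphaOne q : ℤ)) = ⌈q⌉ - 1 := by
    unfold alphaOne; rw [Int.toNat_of_nonneg]; omega
  exact_mod_cast this

lemma alphaOne_lt {q : ℝ} (hq : 1 < q) : (alphaOne q : ℝ) < q := by
  rw [alphaOne_cast hq]; linarith [Int.ceil_lt_add_one q]

lemma le_alphaOne_add_one {q : ℝ} (hq : 1 < q) : q ≤ alphaOne q + 1 := by
  rw [alphaOne_cast hq]; linarith [Int.le_ceil q]

lemma alphaOne_eq {p : ℝ} {k : ℕ} (h1 : (k : ℝ) < p) (h2 : p ≤ k + 1) : alphaOne p = k := by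
  have : ⌈p⌉ = (k : ℤ) + 1 := by
    rw [Int.ceil_eq_iff]; push_cast; constructor <;> linarith
  simp [alphaOne, this]

lemma alphaOne_pos {q : ℝ} (hq : 1 < q) : 0 < alphaOne q := by
  have := le_alphaOne_add_one hq
  have : (0 : ℝ) < alphaOne q := by linarith
  exact_mod_cast this

lemma one_le_maxVal {q : ℝ} (hq : 1 < q) : 1 ≤ maxVal q := by
  unfold maxVal
  rw [le_div_iff₀ (by linarith)]
  linarith [le_alphaOne_add_one hq]

lemma mul_maxVal {q : ℝ} (hq : 1 < q) : q * maxVal q = alphaOne q + maxVal q := by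
  unfold maxVal
  have : q - 1 ≠ 0 := by linarith
  field_simp; ring

lemma hasSum_const_digit {q : ℝ} (hq : 1 < q) (A : ℝ) :
    HasSum (fun i : ℕ => A / q ^ (i + 1)) (A / (q - 1)) := by
  have h := (hasSum_geometric_of_lt_one (r := q⁻¹) (by positivity)
    (inv_lt_one_of_one_lt₀ hq)).mul_left (A / q)
  have h0 : q ≠ 0 := by linarith
  have h1 : q - 1 ≠ 0 := by linarith
  have e1 : (fun i : ℕ => A / q ^ (i + 1)) = fun i => A / q * q⁻¹ ^ i := by
    funext i
    rw [pow_succ, inv_pow]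
    field_simp
  have e2 : A / (q - 1) = A / q * (1 - q⁻¹)⁻¹ := by
    field_simp
  rw [e1, e2]
  exact h

lemma summable_digits {q : ℝ} (hq : 1 < q) {c : ℕ → ℕ} {A : ℕ} (hc : ∀ i, c i ≤ A) :
    Summable (fun i => (c i : ℝ) / q ^ (i + 1)) := by
  refine Summable.of_nonneg_of_le (fun i => by positivity) (fun i => ?_)
    (hasSum_const_digit hq A).summable
  have : (c i : ℝ) ≤ A := by exact_mod_cast hc i
  gcongr

lemma bval_nonneg {q : ℝ} (hq : 1 < q) (c : ℕ → ℕ) : 0 ≤ bval q c :=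
  tsum_nonneg fun i => by positivity

lemma bval_conj {q : ℝ} (hq : 1 < q) {c : ℕ → ℕ} (hc : ∀ i, c i ≤ alphaOne q) :
    bval q (conjSeq q c) = maxVal q - bval q c := by
  have h := (hasSum_const_digit hq (alphaOne q)).sub (summable_digits hq hc).hasSum
  rw [bval, maxVal, bval, ← h.tsum_eq]
  congr 1; funext i
  simp [conjSeq, Nat.cast_sub (hc i), sub_div]

lemma bval_le_maxVal {q : ℝ} (hq : 1 < q) {c : ℕ → ℕ} (hc : ∀ i, c i ≤ alphaOne q) :
    bval q c ≤ maxVal q := by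
  linarith [bval_conj hq hc, bval_nonneg hq (conjSeq q c)]

lemma bval_pos {q : ℝ} (hq : 1 < q) {c : ℕ → ℕ} {A : ℕ} (hc : ∀ i, c i ≤ A) {n : ℕ}
    (hn : c n ≠ 0) : 0 < bval q c := by
  refine (summable_digits hq hc).tsum_pos (fun i => by positivity) n ?_
  have : 0 < c n := Nat.pos_of_ne_zero hn
  positivity

lemma bval_zero (q : ℝ) : bval q (fun _ => 0) = 0 := by simp [bval]

lemma bval_succ {q : ℝ} (hq : 1 < q) {c : ℕ → ℕ} {A : ℕ} (hc : ∀ i, c i ≤ A) :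
    bval q c = (c 0 + bval q (seqDrop 1 c)) / q := by
  unfold bval
  rw [(summable_digits hq hc).tsum_eq_zero_add, add_div, ← tsum_div_const]
  congr 1
  · simp
  · congr 1; funext i
    have : q ≠ 0 := by linarith
    rw [seqDrop, add_comm 1 i, pow_succ q (i + 1)]
    field_simp

lemma bval_split {q : ℝ} (hq : 1 < q) {c : ℕ → ℕ} {A : ℕ} (hc : ∀ i, c i ≤ A) (n : ℕ) :
    bval q c = ∑ i ∈ Finset.range n, (c i : ℝ) / q ^ (i + 1) + bval q (seqDrop n c) / q ^ n := by
  have h0 : q ≠ 0 := by linarith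
  induction n with
  | zero => simp [seqDrop_zero]
  | succ n ih =>
    rw [ih, Finset.sum_range_succ,
      bval_succ hq (c := seqDrop n c) (A := A) (fun i => hc _), seqDrop_seqDrop]
    simp only [seqDrop, add_zero]
    field_simp; ring

/-- The values of two sequences with a common prefix of length `n`. -/
lemma bval_sub_of_prefix {q : ℝ} (hq : 1 < q) {c d : ℕ → ℕ} {A : ℕ} (hc : ∀ i, c i ≤ A)
    (hd : ∀ i, d i ≤ A) {n : ℕ} (h : ∀ i, i < n → c i = d i) :
    (bval q c - bval q d) * q ^ n = bval q (seqDrop n c) - bval q (seqDrop n d) := by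
  have h0 : q ≠ 0 := by linarith
  rw [bval_split hq hc n, bval_split hq hd n,
    Finset.sum_congr rfl (fun i hi => by rw [h i (Finset.mem_range.1 hi)])]
  field_simp; ring

lemma bval_sub_of_prefix_succ {q : ℝ} (hq : 1 < q) {c d : ℕ → ℕ} {A : ℕ} (hc : ∀ i, c i ≤ A)
    (hd : ∀ i, d i ≤ A) {n : ℕ} (h : ∀ i, i < n → c i = d i) :
    (bval q c - bval q d) * q ^ (n + 1) =
      c n + bval q (seqDrop (n + 1) c) - (d n + bval q (seqDrop (n + 1) d)) := by
  have h0 : q ≠ 0 := by linarith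
  rw [pow_succ, ← mul_assoc, bval_sub_of_prefix hq hc hd h,
    bval_succ hq (c := seqDrop n c) (A := A) (fun i => hc _),
    bval_succ hq (c := seqDrop n d) (A := A) (fun i => hd _), seqDrop_seqDrop, seqDrop_seqDrop]
  simp only [seqDrop, add_zero]
  field_simp

lemma lexLt_trichotomy (a b : ℕ → ℕ) : LexLt a b ∨ a = b ∨ LexLt b a := by
  by_cases h : a = b
  · exact Or.inr (Or.inl h)
  · have hex : ∃ n, a n ≠ b n := by
      by_contra! hh; exact h (funext hh)
    have hmin : ∀ i, i < Nat.find hex → a i = b i := fun i hi => by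
      simpa using Nat.find_min hex hi
    rcases lt_or_gt_of_ne (Nat.find_spec hex) with h1 | h1
    · exact Or.inl ⟨_, hmin, h1⟩
    · exact Or.inr (Or.inr ⟨_, fun i hi => (hmin i hi).symm, h1⟩)

lemma not_lexLe_of_lexLt {a b : ℕ → ℕ} (h : LexLt a b) : ¬ LexLe b a := by
  obtain ⟨n, hn, hlt⟩ := h
  rintro (⟨m, hm, hlt'⟩ | rfl)
  · rcases lt_trichotomy m n with h1 | rfl | h1
    · have := hn m h1; omega
    · omega
    · have := hm n h1; omega
  · omega

lemma lexLe_of_not_lexLt {a b : ℕ → ℕ} (h : ¬ LexLt a b) : LexLe b a := by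
  rcases lexLt_trichotomy a b with h1 | h1 | h1
  · exact absurd h1 h
  · exact Or.inr h1.symm
  · exact Or.inl h1

lemma lexLe_antisymm {a b : ℕ → ℕ} (h : LexLe a b) (h' : LexLe b a) : a = b := by
  rcases h with h | h
  · exact absurd h' (not_lexLe_of_lexLt h)
  · exact h

/-- The remainders of the quasi-greedy algorithm. -/
def qgRem (q y : ℝ) : ℕ → ℝ
  | 0 => y
  | n + 1 => q * qgRem q y n - (min (alphaOne q) (⌈q * qgRem q y n⌉₊ - 1) : ℕ)

/-- The digits produced by the quasi-greedy algorithm. -/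
def qgDigit (q y : ℝ) (n : ℕ) : ℕ := min (alphaOne q) (⌈q * qgRem q y n⌉₊ - 1)

lemma qgRem_succ (q y : ℝ) (n : ℕ) :
    qgRem q y (n + 1) = q * qgRem q y n - qgDigit q y n := rfl

lemma qg_step {q : ℝ} (hq : 1 < q) {y : ℝ} {n : ℕ} (h0 : 0 < qgRem q y n)
    (h1 : qgRem q y n ≤ maxVal q) :
    0 < qgRem q y (n + 1) ∧ qgRem q y (n + 1) ≤ maxVal q ∧
      (qgDigit q y n < alphaOne q → qgRem q y (n + 1) ≤ 1) := by
  have hpos : 0 < q * qgRem q y n := by positivity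
  have hc := Nat.ceil_lt_add_one hpos.le
  have hc' := Nat.le_ceil (q * qgRem q y n)
  have hc1 : 1 ≤ ⌈q * qgRem q y n⌉₊ := Nat.one_le_ceil_iff.2 hpos
  have hcast : ((⌈q * qgRem q y n⌉₊ - 1 : ℕ) : ℝ) = ⌈q * qgRem q y n⌉₊ - 1 := by
    push_cast [hc1]; ring
  have hd : (qgDigit q y n : ℝ) ≤ ⌈q * qgRem q y n⌉₊ - 1 := by
    rw [← hcast]; exact_mod_cast min_le_right _ _
  have hlt : qgDigit q y n < alphaOne q → qgRem q y (n + 1) ≤ 1 := by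
    intro h
    have : qgDigit q y n = ⌈q * qgRem q y n⌉₊ - 1 := by
      unfold qgDigit at h ⊢; omega
    rw [qgRem_succ, this, hcast]; linarith
  refine ⟨by rw [qgRem_succ]; linarith, ?_, hlt⟩
  have hle : qgDigit q y n ≤ alphaOne q := min_le_left _ _
  rcases hle.lt_or_eq with h | h
  · exact (hlt h).trans (one_le_maxVal hq)
  · rw [qgRem_succ, h]
    nlinarith [mul_maxVal hq]

lemma exists_infinite_expansion {q : ℝ} (hq : 1 < q) {y : ℝ} (h0 : 0 < y) (h1 : y ≤ maxVal q) :
    ∃ a : ℕ → ℕ, (∀ i, a i ≤ alphaOne q) ∧ bval q a = y ∧ InfiniteSeq a ∧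
      ∀ n, a n < alphaOne q → bval q (seqDrop (n + 1) a) ≤ 1 := by
  have hinv : ∀ n, 0 < qgRem q y n ∧ qgRem q y n ≤ maxVal q := by
    intro n
    induction n with
    | zero => exact ⟨h0, h1⟩
    | succ n ih => exact ⟨(qg_step hq ih.1 ih.2).1, (qg_step hq ih.1 ih.2).2.1⟩
  have hA : ∀ i, qgDigit q y i ≤ alphaOne q := fun i => min_le_left _ _
  have hq0 : q ≠ 0 := by linarith
  have hpart : ∀ m n, qgRem q y m = ∑ i ∈ Finset.range n,
      (seqDrop m (qgDigit q y) i : ℝ) / q ^ (i + 1) + qgRem q y (m + n) / q ^ n := by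
    intro m n
    induction n with
    | zero => simp
    | succ n ih =>
      rw [ih, Finset.sum_range_succ, ← add_assoc m n 1, qgRem_succ, seqDrop]
      field_simp; ring
  have hval : ∀ m, bval q (seqDrop m (qgDigit q y)) = qgRem q y m := by
    intro m
    have hs := (summable_digits hq (c := seqDrop m (qgDigit q y))
      (fun i => hA _)).hasSum.tendsto_sum_nat
    have hz : Filter.Tendsto (fun n => qgRem q y (m + n) / q ^ n) Filter.atTop (nhds 0) := by
      refine squeeze_zero (g := fun n => maxVal q * (q⁻¹) ^ n)
        (fun n => div_nonneg (hinv _).1.le (by positivity)) (fun n => ?_) ?_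
      · rw [inv_pow, ← div_eq_mul_inv]
        have := (hinv (m + n)).2
        gcongr
      · simpa using (tendsto_pow_atTop_nhds_zero_of_lt_one (by positivity)
          (inv_lt_one_of_one_lt₀ hq)).const_mul (maxVal q)
    have hs' := hs.add hz
    simp only [← hpart] at hs'
    rw [add_zero] at hs'
    exact tendsto_nhds_unique hs' tendsto_const_nhds
  refine ⟨qgDigit q y, hA, by simpa [seqDrop_zero, qgRem] using hval 0, ?_, ?_⟩
  · refine Set.infinite_of_not_bddAbove ?_
    rintro ⟨N, hN⟩
    have := (hinv (N + 1)).1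
    rw [← hval] at this
    have hz : seqDrop (N + 1) (qgDigit q y) = fun _ => 0 := by
      funext i
      by_contra hne
      have := hN (show N + 1 + i ∈ {i | qgDigit q y i ≠ 0} from hne)
      omega
    rw [hz, bval_zero] at this
    exact lt_irrefl _ this
  · intro n hn
    rw [hval]
    exact (qg_step hq (hinv n).1 (hinv n).2).2.2 hn

lemma exists_expansion {q : ℝ} (hq : 1 < q) {y : ℝ} (h0 : 0 ≤ y) (h1 : y ≤ maxVal q) :
    ∃ a : ℕ → ℕ, (∀ i, a i ≤ alphaOne q) ∧ bval q a = y := by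
  rcases h0.eq_or_lt with rfl | h0
  · exact ⟨fun _ => 0, fun _ => Nat.zero_le _, bval_zero q⟩
  · obtain ⟨a, ha, hv, -⟩ := exists_infinite_expansion hq h0 h1
    exact ⟨a, ha, hv⟩

lemma InfiniteSeq.bval_drop_pos {q : ℝ} (hq : 1 < q) {c : ℕ → ℕ} (hi : InfiniteSeq c) {A : ℕ}
    (hc : ∀ i, c i ≤ A) (n : ℕ) : 0 < bval q (seqDrop n c) := by
  obtain ⟨m, hm, hnm⟩ := hi.exists_gt n
  refine bval_pos hq (fun i => hc _) (n := m - n) ?_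
  simpa [seqDrop, Nat.add_sub_cancel' hnm.le] using hm

lemma quasiGreedy_eq {q : ℝ} (hq : 1 < q) {a : ℕ → ℕ} (ha : ∀ i, a i ≤ alphaOne q)
    (hi : InfiniteSeq a) (h : ∀ n, a n < alphaOne q → bval q (seqDrop (n + 1) a) ≤ 1) :
    quasiGreedy q (bval q a) = a := by
  have hqg : IsQuasiGreedyOf q (bval q a) a := by
    refine ⟨⟨ha, rfl⟩, hi, ?_⟩
    rintro c ⟨hc, hca⟩ hci
    apply lexLe_of_not_lexLt
    rintro ⟨n, hn, hlt⟩
    have h1 := h n (hlt.trans_le (hc n))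
    have h2 := bval_sub_of_prefix_succ hq ha hc hn
    have h3 : bval q a = bval q c := hca
    rw [h3, sub_self, zero_mul] at h2
    have h4 := hci.bval_drop_pos hq hc (n + 1)
    have h5 : (a n : ℝ) + 1 ≤ c n := by exact_mod_cast hlt
    linarith
  have hex : ∃ b, IsQuasiGreedyOf q (bval q a) b := ⟨a, hqg⟩
  have hb := hex.choose_spec
  rw [quasiGreedy, dif_pos hex]
  exact lexLe_antisymm (hqg.2.2 _ hb.1 hb.2.1) (hb.2.2 _ hqg.1 hqg.2.1)

lemma quasiGreedy_spec {q : ℝ} (hq : 1 < q) {y : ℝ} (h0 : 0 < y) (h1 : y ≤ maxVal q) :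
    (∀ i, quasiGreedy q y i ≤ alphaOne q) ∧ bval q (quasiGreedy q y) = y ∧
      InfiniteSeq (quasiGreedy q y) ∧
      ∀ n, quasiGreedy q y n < alphaOne q → bval q (seqDrop (n + 1) (quasiGreedy q y)) ≤ 1 := by
  obtain ⟨a, ha, rfl, hi, h⟩ := exists_infinite_expansion hq h0 h1
  rw [quasiGreedy_eq hq ha hi h]
  exact ⟨ha, rfl, hi, h⟩

lemma quasiGreedy_zero {q : ℝ} (hq : 1 < q) : quasiGreedy q 0 = fun _ => 0 := by
  rw [quasiGreedy, dif_neg]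
  rintro ⟨a, ⟨ha, h0⟩, hi, -⟩
  have := hi.bval_drop_pos hq ha 0
  rw [seqDrop_zero] at this
  exact this.ne h0

lemma conjSeq_le (q : ℝ) (c : ℕ → ℕ) (i : ℕ) : conjSeq q c i ≤ alphaOne q := Nat.sub_le _ _

lemma bval_drop_conjSeq {q : ℝ} (hq : 1 < q) {c : ℕ → ℕ} (hc : ∀ i, c i ≤ alphaOne q) (n : ℕ) :
    bval q (seqDrop n (conjSeq q c)) = maxVal q - bval q (seqDrop n c) :=
  bval_conj hq fun _ => hc _

lemma Good.conj {q : ℝ} (hq : 1 < q) {c : ℕ → ℕ} (hc : Good q c) : Good q (conjSeq q c) := by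
  obtain ⟨h0, h1, h2⟩ := hc
  refine ⟨conjSeq_le q c, fun n hn => ?_, fun n hn => ?_⟩
  · rw [bval_drop_conjSeq hq h0]
    linarith [h2 n (by have := h0 n; simp only [conjSeq] at hn; omega)]
  · rw [bval_drop_conjSeq hq h0]
    linarith [h1 n (by simp only [conjSeq] at hn; omega)]

lemma Crit.conj {q : ℝ} (hq : 1 < q) {c : ℕ → ℕ} (h0 : ∀ i, c i ≤ alphaOne q) (hc : Crit q c) :
    Crit q (conjSeq q c) := by
  obtain ⟨n, ⟨h1, h2⟩ | ⟨h1, h2⟩⟩ := hc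
  · refine ⟨n, Or.inr ⟨by simp only [conjSeq]; omega, ?_⟩⟩
    rw [bval_drop_conjSeq hq h0, h2]
  · refine ⟨n, Or.inl ⟨by have := h0 n; simp only [conjSeq]; omega, ?_⟩⟩
    rw [bval_drop_conjSeq hq h0, h2]; ring

/-- Changing one digit of the unique expansion makes the tail leave `J_q`. -/
lemma not_mem_Uq_of_digit {q : ℝ} (hq : 1 < q) {c : ℕ → ℕ} (hc : ∀ i, c i ≤ alphaOne q) {n k : ℕ}
    (hk : k ≤ alphaOne q) (hne : k ≠ c n) {y : ℝ} (h0 : 0 ≤ y) (h1 : y ≤ maxVal q)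
    (h : k + y = c n + bval q (seqDrop (n + 1) c)) : bval q c ∉ Uq q := by
  rintro ⟨d, -, hd⟩
  obtain ⟨b, hb, rfl⟩ := exists_expansion hq h0 h1
  set e : ℕ → ℕ := fun i => if i < n then c i else if i = n then k else b (i - (n + 1)) with he
  have heA : ∀ i, e i ≤ alphaOne q := by
    intro i
    simp only [he]
    split_ifs
    exacts [hc _, hk, hb _]
  have hen : e n = k := by simp [he]
  have hed : seqDrop (n + 1) e = b := by
    funext i
    have h1 : ¬ n + 1 + i < n := by omega
    have h2 : ¬ n + 1 + i = n := by omega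
    simp [seqDrop, he, h1, h2]
  have hv := bval_sub_of_prefix_succ hq heA hc (n := n) (fun i hi => by simp [he, hi])
  rw [hen, hed, h, sub_self] at hv
  have hv' : bval q e = bval q c := by
    have : q ^ (n + 1) ≠ 0 := by positivity
    have := (mul_eq_zero.1 hv).resolve_right this
    linarith
  have e1 : e = d := hd e ⟨heA, hv'.symm⟩
  have e2 : c = d := hd c ⟨hc, rfl⟩
  apply hne
  rw [e2, ← e1, hen]

lemma bval_drop_lt_one_of_mem_Uq {q : ℝ} (hq : 1 < q) {c : ℕ → ℕ} (hc : ∀ i, c i ≤ alphaOne q)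
    (hU : bval q c ∈ Uq q) {n : ℕ} (hn : c n < alphaOne q) :
    bval q (seqDrop (n + 1) c) < 1 := by
  by_contra! h
  refine not_mem_Uq_of_digit hq hc (n := n) (k := c n + 1) hn (by omega)
    (y := bval q (seqDrop (n + 1) c) - 1) (by linarith) ?_ (by push_cast; ring) hU
  linarith [bval_le_maxVal hq (c := seqDrop (n + 1) c) (fun i => hc _)]

lemma lt_bval_drop_of_mem_Uq {q : ℝ} (hq : 1 < q) {c : ℕ → ℕ} (hc : ∀ i, c i ≤ alphaOne q)
    (hU : bval q c ∈ Uq q) {n : ℕ} (hn : 0 < c n) :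
    maxVal q - 1 < bval q (seqDrop (n + 1) c) := by
  by_contra! h
  refine not_mem_Uq_of_digit hq hc (n := n) (k := c n - 1) (by have := hc n; omega) (by omega)
    (y := bval q (seqDrop (n + 1) c) + 1) ?_ (by linarith) (by push_cast [hn]; ring) hU
  linarith [bval_nonneg hq (seqDrop (n + 1) c)]

lemma Good.of_mem_Uq {q : ℝ} (hq : 1 < q) {c : ℕ → ℕ} (hc : ∀ i, c i ≤ alphaOne q)
    (hU : bval q c ∈ Uq q) : Good q c :=
  ⟨hc, fun _ hn => (bval_drop_lt_one_of_mem_Uq hq hc hU hn).le,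
    fun _ hn => (lt_bval_drop_of_mem_Uq hq hc hU hn).le⟩

lemma Crit.not_mem_Uq {q : ℝ} (hq : 1 < q) {c : ℕ → ℕ} (hc : ∀ i, c i ≤ alphaOne q)
    (h : Crit q c) : bval q c ∉ Uq q := by
  intro hU
  obtain ⟨n, ⟨h1, h2⟩ | ⟨h1, h2⟩⟩ := h
  · exact (bval_drop_lt_one_of_mem_Uq hq hc hU h1).ne h2
  · exact (lt_bval_drop_of_mem_Uq hq hc hU h1).ne' h2

lemma Good.crit_of_not_mem_Uq {q : ℝ} (hq : 1 < q) {c : ℕ → ℕ} (hg : Good q c)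
    (hU : bval q c ∉ Uq q) : Crit q c := by
  obtain ⟨hc, h1, h2⟩ := hg
  have : ∃ d, (∀ i, d i ≤ alphaOne q) ∧ bval q c = bval q d ∧ d ≠ c := by
    by_contra! hh
    exact hU ⟨c, ⟨hc, rfl⟩, fun d hd => hh d hd.1 hd.2⟩
  obtain ⟨d, hd, hv, hne⟩ := this
  rcases lexLt_trichotomy c d with ⟨n, hn, hlt⟩ | h | ⟨n, hn, hlt⟩
  · have h3 := bval_sub_of_prefix_succ hq hc hd hn
    rw [hv, sub_self, zero_mul] at h3
    have h5 : (c n : ℝ) + 1 ≤ d n := by exact_mod_cast hlt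
    have h6 := hlt.trans_le (hd n)
    refine ⟨n, Or.inl ⟨h6, le_antisymm (h1 n h6) ?_⟩⟩
    linarith [bval_nonneg hq (seqDrop (n + 1) d)]
  · exact absurd h.symm hne
  · have h3 := bval_sub_of_prefix_succ hq hd hc hn
    rw [hv, sub_self, zero_mul] at h3
    have h5 : (d n : ℝ) + 1 ≤ c n := by exact_mod_cast hlt
    have h6 : 0 < c n := by omega
    refine ⟨n, Or.inr ⟨h6, le_antisymm ?_ (h2 n h6)⟩⟩
    linarith [bval_le_maxVal hq (c := seqDrop (n + 1) d) (fun i => hd _)]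

/-- A lexicographic bound by the quasi-greedy expansion of `1` on all relevant tails bounds
the values of these tails by `1`. -/
lemma bval_le_one_of_lexLe {q : ℝ} (hq : 1 < q) {d : ℕ → ℕ} (hd : ∀ i, d i ≤ alphaOne q)
    {P : ℕ → Prop} (hP : ∀ n, P n → LexLe (seqDrop n d) (quasiGreedy q 1))
    (hstep : ∀ n, d n < alphaOne q → P (n + 1)) {n : ℕ} (hn : P n) :
    bval q (seqDrop n d) ≤ 1 := by
  obtain ⟨hα, hα1, -, -⟩ := quasiGreedy_spec hq one_pos (one_le_maxVal hq)
  set S : Set ℝ := {y | ∃ m, P m ∧ y = bval q (seqDrop m d)}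
  have hbdd : BddAbove S := by
    refine ⟨maxVal q, ?_⟩
    rintro y ⟨m, -, rfl⟩
    exact bval_le_maxVal hq fun i => hd _
  have hmem : ∀ m, P m → bval q (seqDrop m d) ≤ sSup S := fun m hm => le_csSup hbdd ⟨m, hm, rfl⟩
  suffices h : sSup S ≤ 1 from (hmem n hn).trans h
  by_contra! hlt
  have key : sSup S ≤ 1 + (sSup S - 1) / q := by
    refine csSup_le ⟨_, n, hn, rfl⟩ ?_
    rintro y ⟨m, hm, rfl⟩
    have hpos : 0 < (sSup S - 1) / q := div_pos (by linarith) (by linarith)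
    rcases hP m hm with ⟨j, hj, hjlt⟩ | heq
    · have h1 := bval_sub_of_prefix_succ hq (c := seqDrop m d) (fun i => hd _) hα hj
      rw [hα1, seqDrop_seqDrop] at h1
      have h2 := bval_nonneg hq (seqDrop (j + 1) (quasiGreedy q 1))
      have h3 : ((seqDrop m d j : ℕ) : ℝ) + 1 ≤ quasiGreedy q 1 j := by exact_mod_cast hjlt
      have h4 := hmem _ (hstep (m + j) (hjlt.trans_le (hα j)))
      rw [add_assoc] at h4
      have h5 : (bval q (seqDrop m d) - 1) * q ^ (j + 1) ≤ sSup S - 1 := by linarith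
      have h6 : bval q (seqDrop m d) - 1 ≤ (sSup S - 1) / q ^ (j + 1) := by
        rwa [le_div_iff₀ (by positivity)]
      have h7 : (sSup S - 1) / q ^ (j + 1) ≤ (sSup S - 1) / q := by
        apply div_le_div_of_nonneg_left (by linarith) (by linarith)
        exact le_self_pow₀ hq.le (by omega)
      linarith
    · rw [heq, hα1]; linarith
  have : (sSup S - 1) / q < sSup S - 1 := div_lt_self (by linarith) hq
  linarith

lemma exists_good_of_mem_Vq {q : ℝ} (hq : 1 < q) {x : ℝ} (hx : x ∈ Vq q) :
    ∃ c, Good q c ∧ bval q c = x := by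
  obtain ⟨⟨h0, h1⟩, hV⟩ := hx
  rcases h0.eq_or_lt with rfl | h0
  · refine ⟨fun _ => 0, ⟨fun _ => Nat.zero_le _, fun n _ => ?_, fun n hn => ?_⟩, bval_zero q⟩
    · exact (bval_zero q).le.trans zero_le_one
    · simp at hn
  · obtain ⟨ha, hv, -, hle⟩ := quasiGreedy_spec hq h0 h1
    refine ⟨_, ⟨ha, hle, fun n hn => ?_⟩, hv⟩
    have := bval_le_one_of_lexLe hq (conjSeq_le q (quasiGreedy q x))
      (P := fun m => ∃ k, m = k + 1 ∧ 0 < quasiGreedy q x k)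
      (by rintro _ ⟨k, rfl, hk⟩; exact hV k hk)
      (fun n hn => ⟨n, rfl, by simp only [conjSeq] at hn; omega⟩)
      ⟨n, rfl, hn⟩
    rw [bval_drop_conjSeq hq ha] at this
    linarith

lemma eq_alphaOne_of_bval_eq_maxVal {q : ℝ} (hq : 1 < q) {c : ℕ → ℕ} (hc : ∀ i, c i ≤ alphaOne q)
    (h : bval q c = maxVal q) (n : ℕ) : c n = alphaOne q := by
  by_contra hne
  have h1 := bval_conj hq hc
  have h2 := hc n
  have := bval_pos hq (conjSeq_le q c) (n := n) (by simp only [conjSeq]; omega)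
  linarith

lemma Good.bval_mem_Vq {q : ℝ} (hq : 1 < q) {c : ℕ → ℕ} (hg : Good q c) : bval q c ∈ Vq q := by
  obtain ⟨hc, h1, h2⟩ := hg
  refine ⟨⟨bval_nonneg hq c, bval_le_maxVal hq hc⟩, ?_⟩
  rcases (bval_nonneg hq c).eq_or_lt with hz | hpos
  · rw [← hz, quasiGreedy_zero hq]
    intro n hn
    simp at hn
  obtain ⟨hα, hα1, -, hαle⟩ := quasiGreedy_spec hq one_pos (one_le_maxVal hq)
  rcases (one_le_maxVal hq).eq_or_lt with hM | hM
  · intro n _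
    apply lexLe_of_not_lexLt
    rintro ⟨j, -, hj⟩
    rw [eq_alphaOne_of_bval_eq_maxVal hq hα (hα1.trans hM)] at hj
    exact absurd hj (Nat.sub_le _ _).not_gt
  have hi : InfiniteSeq c := by
    by_contra hfin
    rw [InfiniteSeq, Set.not_infinite] at hfin
    have hne : {i | c i ≠ 0}.Nonempty := by
      by_contra hempty
      have : c = fun _ => 0 := by
        funext i
        by_contra hi
        exact hempty ⟨i, hi⟩
      rw [this, bval_zero] at hpos
      exact lt_irrefl _ hpos
    obtain ⟨n, hn, hmax⟩ := hfin.exists_maximal hne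
    have h3 := h2 n (Nat.pos_of_ne_zero hn)
    have : seqDrop (n + 1) c = fun _ => 0 := by
      funext i
      by_contra hi
      have := hmax (y := n + 1 + i) hi (by omega)
      omega
    rw [this, bval_zero] at h3
    linarith
  rw [quasiGreedy_eq hq hc hi h1]
  intro n hn
  apply lexLe_of_not_lexLt
  rintro ⟨j, hj, hjlt⟩
  change ∀ i, i < j → _ = seqDrop (n + 1) (conjSeq q c) i at hj
  change _ < seqDrop (n + 1) (conjSeq q c) j at hjlt
  have h3 := bval_sub_of_prefix_succ hq (d := seqDrop (n + 1) (conjSeq q c)) hα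
    (fun i => conjSeq_le q c _) hj
  have h4 := hαle j (hjlt.trans_le (conjSeq_le q c _))
  rw [seqDrop_seqDrop, bval_drop_conjSeq hq hc, bval_drop_conjSeq hq hc, hα1] at h3
  have h5 := h2 n hn
  have h6 := h1 (n + 1 + j) (by simp only [seqDrop, conjSeq] at hjlt; omega)
  have h7 : (quasiGreedy q 1 j : ℝ) + 1 ≤ (seqDrop (n + 1) (conjSeq q c) j : ℕ) := by
    exact_mod_cast hjlt
  have h8 : 0 ≤ (1 - (maxVal q - bval q (seqDrop (n + 1) c))) * q ^ (j + 1) :=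
    mul_nonneg (by linarith) (by positivity)
  rw [← add_assoc] at h3
  linarith

lemma mem_Vq_diff_Uq {q : ℝ} (hq : 1 < q) {c : ℕ → ℕ} (hg : Good q c) (hc : Crit q c) :
    bval q c ∈ Vq q \ Uq q :=
  ⟨hg.bval_mem_Vq hq, hc.not_mem_Uq hq hg.1⟩

lemma exists_good_crit {q : ℝ} (hq : 1 < q) {x : ℝ} (hx : x ∈ Vq q \ Uq q) :
    ∃ c, Good q c ∧ Crit q c ∧ bval q c = x := by
  obtain ⟨c, hg, rfl⟩ := exists_good_of_mem_Vq hq hx.1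
  exact ⟨c, hg, hg.crit_of_not_mem_Uq hq hx.2, rfl⟩

lemma exists_foldr_eq_bval {q : ℝ} (hq : 1 < q) {A : ℕ} (n : ℕ) {c : ℕ → ℕ} (hc : ∀ i, c i ≤ A) :
    ∃ l : List ℕ, bval q c = l.foldr (fun (d : ℕ) s => ((d : ℝ) + s) / q) (bval q (seqDrop n c)) := by
  induction n generalizing c with
  | zero => exact ⟨[], by simp [seqDrop_zero]⟩
  | succ n ih =>
    obtain ⟨l, hl⟩ := ih (c := seqDrop 1 c) fun i => hc _
    refine ⟨c 0 :: l, ?_⟩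
    rw [bval_succ hq hc, hl, seqDrop_seqDrop, add_comm 1 n, List.foldr_cons]

lemma countable_Vq_diff_Uq {q : ℝ} (hq : 1 < q) : (Vq q \ Uq q).Countable := by
  refine (Set.countable_range fun p : List ℕ × Bool =>
    p.1.foldr (fun (d : ℕ) s => ((d : ℝ) + s) / q) (if p.2 then 1 else maxVal q - 1)).mono ?_
  intro x hx
  obtain ⟨c, hg, ⟨n, hn⟩, rfl⟩ := exists_good_crit hq hx
  obtain ⟨l, hl⟩ := exists_foldr_eq_bval hq (n + 1) hg.1
  rcases hn with hn | hn
  · exact ⟨(l, true), by simp [hl, hn.2]⟩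
  · exact ⟨(l, false), by simp [hl, hn.2]⟩

/-- Replace the tail of `c` after position `n` by `e`. -/
def spliceSeq (n : ℕ) (c e : ℕ → ℕ) : ℕ → ℕ := fun i => if i < n then c i else e (i - n)

lemma spliceSeq_of_lt {n i : ℕ} (c e : ℕ → ℕ) (h : i < n) : spliceSeq n c e i = c i := if_pos h

lemma spliceSeq_add (n i : ℕ) (c e : ℕ → ℕ) : spliceSeq n c e (n + i) = e i := by
  simp [spliceSeq]

lemma seqDrop_spliceSeq (n i : ℕ) (c e : ℕ → ℕ) :
    seqDrop (n + i) (spliceSeq n c e) = seqDrop i e := by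
  funext j; simp [seqDrop, spliceSeq, add_assoc]

lemma spliceSeq_le {n A : ℕ} {c e : ℕ → ℕ} (hc : ∀ i, c i ≤ A) (he : ∀ i, e i ≤ A) (i : ℕ) :
    spliceSeq n c e i ≤ A := by
  unfold spliceSeq; split_ifs
  exacts [hc _, he _]

/-- Replacing a tail by a good expansion of `1` at a record position keeps the sequence good. -/
lemma good_crit_spliceSeq {q : ℝ} (hq : 1 < q) {c e : ℕ → ℕ} (hc : Good q c) (he : Good q e)
    (he1 : bval q e = 1) {n : ℕ} (hn : c n < alphaOne q)
    (hrec : ∀ k, k ≤ n → c k < alphaOne q →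
      (1 - bval q (seqDrop (n + 1) c)) / q ^ (n + 1) ≤
        (1 - bval q (seqDrop (k + 1) c)) / q ^ (k + 1)) :
    Good q (spliceSeq (n + 1) c e) ∧ Crit q (spliceSeq (n + 1) c e) := by
  set d := spliceSeq (n + 1) c e with hd
  have hdA : ∀ i, d i ≤ alphaOne q := spliceSeq_le hc.1 he.1
  have hdc : ∀ k, k ≤ n → d k = c k := fun k hk => spliceSeq_of_lt c e (by omega)
  have hdn : bval q (seqDrop (n + 1) d) = 1 := by
    rw [hd, show n + 1 = n + 1 + 0 from rfl, seqDrop_spliceSeq, seqDrop_zero, he1]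
  have hval : ∀ k, k ≤ n → bval q (seqDrop (k + 1) d) = bval q (seqDrop (k + 1) c) +
      q ^ (k + 1) * ((1 - bval q (seqDrop (n + 1) c)) / q ^ (n + 1)) := by
    intro k hk
    have h := bval_sub_of_prefix hq (c := seqDrop (k + 1) d) (d := seqDrop (k + 1) c)
      (fun i => hdA _) (fun i => hc.1 _) (n := n - k) (fun i hi => hdc _ (by omega))
    rw [seqDrop_seqDrop, seqDrop_seqDrop, show k + 1 + (n - k) = n + 1 by omega, hdn] at h
    have hp : q ^ (n + 1) = q ^ (k + 1) * q ^ (n - k) := by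
      rw [← pow_add]; congr 1; omega
    rw [← h, hp]
    have : q ≠ 0 := by linarith
    field_simp; ring
  have hpos : 0 ≤ (1 - bval q (seqDrop (n + 1) c)) / q ^ (n + 1) :=
    div_nonneg (by linarith [hc.2.1 n hn]) (by positivity)
  refine ⟨⟨hdA, fun k hk => ?_, fun k hk => ?_⟩, n, Or.inl ⟨by rwa [hdc n le_rfl], hdn⟩⟩
  · rcases le_or_gt k n with hkn | hkn
    · rw [hdc k hkn] at hk
      have h := mul_le_mul_of_nonneg_left (hrec k hkn hk) (by positivity : 0 ≤ q ^ (k + 1))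
      rw [mul_div_cancel₀ _ (by positivity : q ^ (k + 1) ≠ 0)] at h
      rw [hval k hkn]; linarith
    · obtain ⟨j, rfl⟩ := Nat.exists_eq_add_of_le (show n + 1 ≤ k from hkn)
      rw [hd, add_assoc (n + 1), seqDrop_spliceSeq]
      rw [hd, spliceSeq_add] at hk
      exact he.2.1 j hk
  · rcases le_or_gt k n with hkn | hkn
    · rw [hdc k hkn] at hk
      rw [hval k hkn]
      have := hc.2.2 k hk
      have : 0 ≤ q ^ (k + 1) * ((1 - bval q (seqDrop (n + 1) c)) / q ^ (n + 1)) :=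
        mul_nonneg (by positivity) hpos
      linarith
    · obtain ⟨j, rfl⟩ := Nat.exists_eq_add_of_le (show n + 1 ≤ k from hkn)
      rw [hd, add_assoc (n + 1), seqDrop_spliceSeq]
      rw [hd, spliceSeq_add] at hk
      exact he.2.2 j hk

/-- A positive sequence tending to `0` has arbitrarily late running minima along any infinite
set of indices. -/
lemma exists_running_min {I : Set ℕ} (hI : I.Infinite) {δ : ℕ → ℝ} (hpos : ∀ n ∈ I, 0 < δ n)
    (hδ : Filter.Tendsto δ Filter.atTop (nhds 0)) (N : ℕ) :
    ∃ n ∈ I, N ≤ n ∧ ∀ k ∈ I, k ≤ n → δ n ≤ δ k := by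
  have hev : ∀ᶠ m in Filter.atTop, ∀ k ∈ {k | k < N ∧ k ∈ I}, δ m < δ k := by
    rw [Filter.eventually_all_finite ((Set.finite_lt_nat N).subset fun k hk => hk.1)]
    exact fun k hk => hδ.eventually_lt_const (hpos k hk.2)
  obtain ⟨m, hmI, hm, hNm⟩ := ((Nat.frequently_atTop_iff_infinite.2 hI).and_eventually
    (hev.and (Filter.eventually_ge_atTop N))).exists
  obtain ⟨n, ⟨hnI, hNn, hnm⟩, hmin⟩ := Set.exists_min_image {k | k ∈ I ∧ N ≤ k ∧ k ≤ m} δ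
    ((Set.finite_le_nat m).subset fun k hk => hk.2.2) ⟨m, hmI, hNm, le_rfl⟩
  refine ⟨n, hnI, hNn, fun k hk hkn => ?_⟩
  rcases lt_or_ge k N with h | h
  · exact (hmin m ⟨hmI, hNm, le_rfl⟩).trans (hm k ⟨h, hk⟩).le
  · exact hmin k ⟨hk, h, hkn.trans hnm⟩

lemma tendsto_const_div_pow_of_one_lt {q : ℝ} (hq : 1 < q) (B : ℝ) :
    Filter.Tendsto (fun n : ℕ => B / q ^ n) Filter.atTop (nhds 0) := by
  simpa [div_eq_mul_inv] using (tendsto_pow_atTop_nhds_zero_of_lt_one (r := q⁻¹) (by positivity)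
    (inv_lt_one_of_one_lt₀ hq)).const_mul B

lemma exists_near_of_infinite {q : ℝ} (hq : 1 < q) {c e : ℕ → ℕ} (hc : Good q c)
    (hstrict : ∀ n, c n < alphaOne q → bval q (seqDrop (n + 1) c) < 1)
    (hinf : {n | c n < alphaOne q}.Infinite) (he : Good q e) (he1 : bval q e = 1)
    {ε : ℝ} (hε : 0 < ε) :
    ∃ d, Good q d ∧ Crit q d ∧ |bval q d - bval q c| < ε := by
  have hlim : Filter.Tendsto (fun n => (1 - bval q (seqDrop (n + 1) c)) / q ^ (n + 1))
      Filter.atTop (nhds 0) := by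
    refine squeeze_zero_norm (fun n => ?_)
      ((tendsto_const_div_pow_of_one_lt hq (1 + maxVal q)).comp (Filter.tendsto_add_atTop_nat 1))
    have h1 := bval_nonneg hq (seqDrop (n + 1) c)
    have h2 := bval_le_maxVal hq (c := seqDrop (n + 1) c) fun i => hc.1 _
    rw [Real.norm_eq_abs, abs_div, abs_of_pos (by positivity : 0 < q ^ (n + 1))]
    refine div_le_div_of_nonneg_right ?_ (by positivity)
    rw [abs_le]; constructor <;> linarith
  obtain ⟨N, hN⟩ :=
    ((tendsto_const_div_pow_of_one_lt hq (maxVal q)).eventually_lt_const hε).exists_forall_of_atTop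
  obtain ⟨n, hn, hNn, hrec⟩ := exists_running_min hinf
    (fun n hn => div_pos (by linarith [hstrict n hn]) (by positivity)) hlim N
  obtain ⟨hd, hcrit⟩ := good_crit_spliceSeq hq hc he he1 hn fun k hkn hk => hrec k hk hkn
  refine ⟨_, hd, hcrit, ?_⟩
  have h := bval_sub_of_prefix hq hd.1 hc.1 (fun i hi => spliceSeq_of_lt c e hi)
  have h1 := bval_nonneg hq (seqDrop (n + 1) c)
  have h2 := bval_le_maxVal hq (c := seqDrop (n + 1) c) fun i => hc.1 _
  have h3 := bval_nonneg hq (seqDrop (n + 1) (spliceSeq (n + 1) c e))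
  have h4 := bval_le_maxVal hq (c := seqDrop (n + 1) (spliceSeq (n + 1) c e)) fun i => hd.1 _
  refine lt_of_le_of_lt ?_ (hN (n + 1) (by omega))
  have hp : 0 < q ^ (n + 1) := by positivity
  rw [le_div_iff₀ hp, ← abs_of_pos hp, ← abs_mul, h, abs_le]
  constructor <;> linarith

lemma Vq_subset_closure_diff {q : ℝ} (hq : 1 < q) {e : ℕ → ℕ} (he : Good q e)
    (he1 : bval q e = 1) : Vq q ⊆ closure (Vq q \ Uq q) := by
  intro x hx
  by_cases hU : x ∈ Uq q
  swap
  · exact subset_closure ⟨hx, hU⟩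
  obtain ⟨c, hc, rfl⟩ := exists_good_of_mem_Vq hq hx
  rw [Metric.mem_closure_iff]
  intro ε hε
  by_cases hinf : {n | c n < alphaOne q}.Infinite
  · obtain ⟨d, hd, hcrit, hdist⟩ := exists_near_of_infinite hq hc
      (fun n hn => bval_drop_lt_one_of_mem_Uq hq hc.1 hU hn) hinf he he1 hε
    exact ⟨_, mem_Vq_diff_Uq hq hd hcrit, by rwa [dist_comm, Real.dist_eq]⟩
  · have hinf' : {n | conjSeq q c n < alphaOne q}.Infinite := by
      refine (Set.not_infinite.1 hinf).infinite_compl.mono fun n hn => ?_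
      have h1 := alphaOne_pos hq
      have h2 : ¬ c n < alphaOne q := hn
      change alphaOne q - c n < alphaOne q
      omega
    obtain ⟨d, hd, hcrit, hdist⟩ := exists_near_of_infinite hq (hc.conj hq)
      (fun n hn => by
        have h1 : 0 < c n := by simp only [conjSeq] at hn; omega
        rw [bval_drop_conjSeq hq hc.1]
        linarith [lt_bval_drop_of_mem_Uq hq hc.1 hU h1]) hinf' he he1 hε
    refine ⟨_, mem_Vq_diff_Uq hq (hd.conj hq) (hcrit.conj hq hd.1), ?_⟩
    rw [bval_conj hq hc.1] at hdist
    rw [bval_conj hq hd.1, Real.dist_eq]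
    convert hdist using 2
    ring

lemma infinite_Vq_diff_Uq {q : ℝ} (hq : 1 < q) {e : ℕ → ℕ} (he : Good q e)
    (he1 : bval q e = 1) : (Vq q \ Uq q).Infinite := by
  have hzero : Good q (fun _ => 0) :=
    ⟨fun _ => Nat.zero_le _, fun n _ => (bval_zero q).le.trans zero_le_one,
      fun n hn => by simp at hn⟩
  have hz : ∀ n, bval q (seqDrop n fun _ => 0) = 0 := fun n => bval_zero q
  have hmem : ∀ n : ℕ, 1 / q ^ (n + 1) ∈ Vq q \ Uq q := by
    intro n
    obtain ⟨hd, hcrit⟩ := good_crit_spliceSeq hq hzero he he1 (n := n) (alphaOne_pos hq)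
      (fun k hk _ => by
        rw [hz, hz]
        exact div_le_div_of_nonneg_left (by norm_num) (by positivity)
          (pow_le_pow_right₀ hq.le (by omega)))
    have h := bval_sub_of_prefix hq hd.1 hzero.1 (fun i hi => spliceSeq_of_lt _ e hi)
    rw [hz, bval_zero, show seqDrop (n + 1) (spliceSeq (n + 1) (fun _ => 0) e) = e from
      (seqDrop_spliceSeq (n + 1) 0 _ e).trans (seqDrop_zero e), he1, sub_zero, sub_zero] at h
    rw [← h, mul_div_cancel_right₀ _ (by positivity)]
    exact mem_Vq_diff_Uq hq hd hcrit
  refine Set.infinite_of_injective_forall_mem (f := fun n : ℕ => 1 / q ^ (n + 1)) ?_ hmem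
  intro m n hmn
  simp only [one_div, inv_inj] at hmn
  have := pow_right_injective₀ (by linarith) hq.ne' hmn
  omega

lemma tendsto_bval {q : ℝ} (hq : 1 < q) {A : ℕ} {p : ℕ → ℝ} {c : ℕ → ℕ → ℕ} {d : ℕ → ℕ}
    (hp : Filter.Tendsto p Filter.atTop (nhds q)) (hA : ∀ᶠ k in Filter.atTop, ∀ i, c k i ≤ A)
    (hc : ∀ i, ∀ᶠ k in Filter.atTop, c k i = d i) :
    Filter.Tendsto (fun k => bval (p k) (c k)) Filter.atTop (nhds (bval q d)) := by
  have hr : 1 < (1 + q) / 2 := by linarith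
  refine tendsto_tsum_of_dominated_convergence (hasSum_const_digit hr A).summable (fun i => ?_) ?_
  · have h1 : Filter.Tendsto (fun k => (d i : ℝ) / p k ^ (i + 1)) Filter.atTop
        (nhds ((d i : ℝ) / q ^ (i + 1))) :=
      tendsto_const_nhds.div (hp.pow _) (by positivity)
    refine h1.congr' ?_
    filter_upwards [hc i] with k hk
    rw [hk]
  · filter_upwards [hA, hp.eventually_const_lt (show (1 + q) / 2 < q by linarith)] with k hk hpk i
    rw [Real.norm_of_nonneg (by have : 0 < p k := by linarith
                                positivity)]
    have : (c k i : ℝ) ≤ A := by exact_mod_cast hk i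
    gcongr

/-- If `q` is a limit of univoque numbers then `1` has a good expansion in base `q`. -/
lemma exists_good_expansion_one {q : ℝ} (hq : 1 < q) (h : q ∈ closure USet) :
    ∃ e, Good q e ∧ bval q e = 1 := by
  rcases (one_le_maxVal hq).eq_or_lt with hM | hM
  · have hle : ∀ i, conjSeq q (fun _ => 0) i ≤ alphaOne q := conjSeq_le q _
    refine ⟨conjSeq q fun _ => 0, ⟨hle, fun n _ => ?_, fun n _ => ?_⟩, ?_⟩
    · rw [hM]; exact bval_le_maxVal hq fun i => hle _
    · rw [← hM, sub_self]; exact bval_nonneg hq _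
    · rw [bval_conj hq (fun _ => Nat.zero_le _), bval_zero, ← hM, sub_zero]
  have hqA : q < alphaOne q + 1 := by
    rw [maxVal, lt_div_iff₀ (by linarith)] at hM; linarith
  obtain ⟨p, hpU, hp⟩ := mem_closure_iff_seq_limit.1 h
  have hAev : ∀ᶠ k in Filter.atTop, alphaOne (p k) = alphaOne q := by
    filter_upwards [hp.eventually_const_lt (alphaOne_lt hq), hp.eventually_lt_const hqA]
      with k h1 h2 using alphaOne_eq h1 h2.le
  obtain ⟨K, hK⟩ := hAev.exists_forall_of_atTop
  replace hp := hp.comp (Filter.tendsto_add_atTop_nat K)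
  set r : ℕ → ℝ := fun k => p (k + K)
  have hA : ∀ k, alphaOne (r k) = alphaOne q := fun k => hK _ (by omega)
  have hr1 : ∀ k, 1 < r k := fun k => (hpU _).1
  have hex : ∀ k, ∃ c, IsExpansionOf (r k) 1 c := fun k => (hpU (k + K)).2.exists
  choose c hc using hex
  have hcA : ∀ k i, c k i ≤ alphaOne q := fun k i => hA k ▸ (hc k).1 i
  have hcU : ∀ k, bval (r k) (c k) ∈ Uq (r k) := fun k => by
    have : bval (r k) (c k) = 1 := (hc k).2.symm
    rw [this]; exact (hpU (k + K)).2
  have hcomp : IsCompact (Set.univ.pi fun _ : ℕ => Set.Iic (alphaOne q)) :=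
    isCompact_univ_pi fun _ => (Set.finite_Iic _).isCompact
  obtain ⟨e, he, φ, hφ, hlim⟩ := hcomp.tendsto_subseq (x := c) fun k i _ => hcA k i
  have heA : ∀ i, e i ≤ alphaOne q := fun i => he i trivial
  have hdig : ∀ i, ∀ᶠ k in Filter.atTop, c (φ k) i = e i := by
    intro i
    have := (tendsto_pi_nhds.1 hlim) i
    rw [nhds_discrete, Filter.tendsto_pure] at this
    exact this
  have hrφ : Filter.Tendsto (fun k => r (φ k)) Filter.atTop (nhds q) :=
    hp.comp hφ.tendsto_atTop
  have htail : ∀ n, Filter.Tendsto (fun k => bval (r (φ k)) (seqDrop n (c (φ k))))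
      Filter.atTop (nhds (bval q (seqDrop n e))) := fun n =>
    tendsto_bval hq hrφ (Filter.Eventually.of_forall fun k i => hcA _ _) fun i => hdig _
  have hMlim : Filter.Tendsto (fun k => maxVal (r (φ k))) Filter.atTop (nhds (maxVal q)) := by
    simp only [maxVal, hA]
    exact tendsto_const_nhds.div (hrφ.sub_const 1) (by linarith)
  refine ⟨e, ⟨heA, fun n hn => ?_, fun n hn => ?_⟩, ?_⟩
  · refine le_of_tendsto (htail (n + 1)) ?_
    filter_upwards [hdig n] with k hk
    exact (bval_drop_lt_one_of_mem_Uq (hr1 _) (hc _).1 (hcU _) (by rw [hk, hA]; exact hn)).le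
  · refine le_of_tendsto_of_tendsto (hMlim.sub_const 1) (htail (n + 1)) ?_
    filter_upwards [hdig n] with k hk
    exact (lt_bval_drop_of_mem_Uq (hr1 _) (hc _).1 (hcU _) (by rw [hk]; exact hn)).le
  · have h0 := htail 0
    simp only [seqDrop_zero] at h0
    refine tendsto_nhds_unique h0 (tendsto_const_nhds.congr fun k => ?_)
    exact (hc _).2

/-- If `q > 1` lies in the closure of `U`, then `V_q \ U_q` is
countably infinite and dense in `V_q`. -/
theorem Vq_diff_Uq_countable_dense (q : ℝ) (hq : 1 < q) (h : q ∈ closure USet) :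
    (Vq q \ Uq q).Countable ∧ (Vq q \ Uq q).Infinite ∧
      Vq q ⊆ closure (Vq q \ Uq q) := by
  obtain ⟨e, he, he1⟩ := exists_good_expansion_one hq h
  exact ⟨countable_Vq_diff_Uq hq, infinite_Vq_diff_Uq hq he he1,
    Vq_subset_closure_diff hq he he1⟩
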